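/- Let t ≥ 3 be an integer. Then there exist a real constant c > 0 and a positive integer n₀ such that for every integer n ≥ n₀ there exists a state on t vessels with sum n that is not p-pourable for any nonnegative integer p < c·log₂ n. -/

import Mathlib

/-- A single pouring step between two vessels of a state on `k` vessels:
choose `i ≠ j` with `A i ≤ A j`, replace `A i` by `2 * A i` and `A j` by
`A j - A i`. -/
def PourStep {k : ℕ} (A B : Fin k → ℕ) : Prop :=
  ∃ i j : Fin k, i ≠ j ∧ A i ≤ A j ∧
    B = Function.update (Function.update A i (2 * A i)) j (A j - A i)

/-- `PourSteps m A B` : the state `B` is reachable from `A` in exactly `m`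
pouring steps. -/
def PourSteps {k : ℕ} : ℕ → (Fin k → ℕ) → (Fin k → ℕ) → Prop
  | 0, A, B => B = A
  | m + 1, A, B => ∃ C, PourStep A C ∧ PourSteps m C B

/-- A state is `p`-pourable if at most `p` pouring steps lead to a state
with an empty vessel. -/
def Pourable {k : ℕ} (p : ℕ) (A : Fin k → ℕ) : Prop :=
  ∃ m ≤ p, ∃ B : Fin k → ℕ, PourSteps m A B ∧ ∃ i, B i = 0

/-- The number of states on `k` vessels with sum `n`. -/
theorem card_finAntidiagonal_nat (k n : ℕ) :
    (Finset.finAntidiagonal k n).card = (k + n - 1).choose n := by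
  have h := Finset.card_finsuppAntidiag_nat_eq_choose (s := (Finset.univ : Finset (Fin k))) n
  rw [Finset.card_univ, Fintype.card_fin] at h
  rw [← h]
  refine Finset.card_equiv Finsupp.equivFunOnFinite.symm fun A => ?_
  simp [Finset.mem_finsuppAntidiag]

theorem PourStep.sum_eq {k : ℕ} {A B : Fin k → ℕ} (h : PourStep A B) :
    ∑ l, B l = ∑ l, A l := by
  obtain ⟨i, j, hij, hle, rfl⟩ := h
  have hi : i ∈ Finset.univ \ {j} := by simpa using hij
  rw [Finset.sum_update_of_mem (Finset.mem_univ j), Finset.sum_update_of_mem hi,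
    Finset.sum_eq_add_sum_sdiff_singleton_of_mem (Finset.mem_univ j) A,
    Finset.sum_eq_add_sum_sdiff_singleton_of_mem hi A]
  omega

/-- The only state that a pouring step from vessel `j` into vessel `i` can lead from to `B`. -/
def unpour {k : ℕ} (i j : Fin k) (B : Fin k → ℕ) : Fin k → ℕ :=
  Function.update (Function.update B i (B i / 2)) j (B j + B i / 2)

theorem PourStep.exists_unpour_eq {k : ℕ} {A B : Fin k → ℕ} (h : PourStep A B) :
    ∃ i j, unpour i j B = A := by
  obtain ⟨i, j, hij, hle, rfl⟩ := h
  refine ⟨i, j, funext fun l => ?_⟩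
  by_cases hj : l = j
  · subst hj
    simp [unpour, hij, hle]
  · by_cases hi : l = i
    · subst hi
      simp [unpour, hij]
    · simp [unpour, hi, hj]

open Classical in
/-- The states with sum `n` from which an empty vessel is reachable in exactly `m` steps. -/
noncomputable def emptyingStates (k n m : ℕ) : Finset (Fin k → ℕ) :=
  {A ∈ Finset.finAntidiagonal k n | ∃ B, PourSteps m A B ∧ ∃ i, B i = 0}

theorem card_emptyingStates_zero_le (k n : ℕ) :
    (emptyingStates (k + 1) n 0).card ≤ (k + 1) * (k + n - 1).choose n := by
  classical
  calc (emptyingStates (k + 1) n 0).card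
      ≤ (((Finset.univ : Finset (Fin (k + 1))) ×ˢ Finset.finAntidiagonal k n).image
          fun x => (x.1.insertNth (0 : ℕ) x.2 : Fin (k + 1) → ℕ)).card := by
        refine Finset.card_le_card fun A hA => ?_
        obtain ⟨hA, B, hB, i, hi⟩ := Finset.mem_filter.1 hA
        obtain rfl : B = A := hB
        rw [Finset.mem_finAntidiagonal, Fin.sum_univ_succAbove _ i, hi, zero_add] at hA
        refine Finset.mem_image.2 ⟨(i, i.removeNth B), ?_, ?_⟩
        · simpa [Fin.removeNth] using hA
        · rw [← hi]
          exact Fin.insertNth_self_removeNth i B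
    _ ≤ _ := Finset.card_image_le
    _ = _ := by simp [card_finAntidiagonal_nat]

theorem card_emptyingStates_succ_le (k n m : ℕ) :
    (emptyingStates k n (m + 1)).card ≤ k ^ 2 * (emptyingStates k n m).card := by
  classical
  calc (emptyingStates k n (m + 1)).card
      ≤ (((Finset.univ : Finset (Fin k × Fin k)) ×ˢ emptyingStates k n m).image
          fun x => unpour x.1.1 x.1.2 x.2).card := by
        refine Finset.card_le_card fun A hA => ?_
        obtain ⟨hA, B, ⟨C, hAC, hCB⟩, hB⟩ := Finset.mem_filter.1 hA
        obtain ⟨i, j, hij⟩ := hAC.exists_unpour_eq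
        refine Finset.mem_image.2 ⟨((i, j), C), ?_, hij⟩
        refine Finset.mem_product.2 ⟨Finset.mem_univ _, Finset.mem_filter.2 ⟨?_, B, hCB, hB⟩⟩
        rw [Finset.mem_finAntidiagonal] at hA ⊢
        rw [hAC.sum_eq, hA]
    _ ≤ _ := Finset.card_image_le
    _ = _ := by simp [sq]

theorem card_emptyingStates_le (k n m : ℕ) :
    (emptyingStates (k + 1) n m).card ≤
      ((k + 1) ^ 2) ^ m * ((k + 1) * (k + n - 1).choose n) := by
  induction m with
  | zero => simpa using card_emptyingStates_zero_le k n
  | succ m ih =>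
    calc _ ≤ _ := card_emptyingStates_succ_le (k + 1) n m
      _ ≤ _ := Nat.mul_le_mul_left _ ih
      _ = _ := by ring

/-- If `n` is large compared to the number of steps, then there are more states with sum `n` than
`p`-pourable ones. -/
theorem exists_not_pourable {k n p : ℕ} (hk : 1 ≤ k) (h : (k + 1) ^ (2 * p + 4) ≤ n) :
    ∃ A : Fin (k + 1) → ℕ, ∑ i, A i = n ∧ ¬ Pourable p A := by
  classical
  by_contra! hp
  have hsub : Finset.finAntidiagonal (k + 1) n ⊆
      (Finset.range (p + 1)).biUnion (emptyingStates (k + 1) n) := by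
    intro A hA
    obtain ⟨m, hm, hB⟩ := hp A (Finset.mem_finAntidiagonal.1 hA)
    exact Finset.mem_biUnion.2 ⟨m, by simpa [Nat.lt_succ_iff] using hm,
      Finset.mem_filter.2 ⟨hA, hB⟩⟩
  set N := (k + n - 1).choose n with hN
  have hchoose : (k + n).choose n * k = (k + n) * N := by
    obtain ⟨k, rfl⟩ := Nat.exists_eq_add_of_le' hk
    have := Nat.add_one_mul_choose_eq (k + n) k
    rw [hN, show k + 1 + n - 1 = k + n by omega, show k + 1 + n = k + n + 1 by omega,
      ← Nat.choose_symm_of_eq_add (show k + n + 1 = (k + 1) + n by omega),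
      ← Nat.choose_symm_of_eq_add (show k + n = k + n by omega)]
    exact this.symm
  have hNpos : 0 < N := Nat.choose_pos (by omega)
  have hgeom : ∑ m ∈ Finset.range (p + 1), ((k + 1) ^ 2) ^ m < ((k + 1) ^ 2) ^ (p + 1) :=
    Nat.geomSum_lt (by nlinarith) (by simp)
  have hcard : (k + n).choose n ≤ ((k + 1) ^ 2) ^ (p + 1) * ((k + 1) * N) :=
    calc (k + n).choose n = (Finset.finAntidiagonal (k + 1) n).card := by
          rw [card_finAntidiagonal_nat]; congr 1; omega
      _ ≤ _ := Finset.card_le_card hsub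
      _ ≤ _ := Finset.card_biUnion_le
      _ ≤ _ := Finset.sum_le_sum fun m _ => card_emptyingStates_le k n m
      _ = _ := (Finset.sum_mul _ _ _).symm
      _ ≤ _ := Nat.mul_le_mul_right _ hgeom.le
  have hlt : (k + n) * N ≤ n * N :=
    calc (k + n) * N = (k + n).choose n * k := hchoose.symm
      _ ≤ ((k + 1) ^ 2) ^ (p + 1) * ((k + 1) * N) * (k + 1) :=
        Nat.mul_le_mul hcard (Nat.le_succ k)
      _ = (k + 1) ^ (2 * p + 4) * N := by rw [← pow_mul]; ring
      _ ≤ n * N := Nat.mul_le_mul_right _ h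
  have := Nat.le_of_mul_le_mul_right hlt hNpos
  omega

theorem Pourable.mono {k p q : ℕ} {A : Fin k → ℕ} (hpq : p ≤ q) (h : Pourable p A) :
    Pourable q A := by
  obtain ⟨m, hm, hB⟩ := h
  exact ⟨m, hm.trans hpq, hB⟩

theorem stmt18 (t : ℕ) (ht : 3 ≤ t) :
    ∃ c : ℝ, 0 < c ∧ ∃ n₀ : ℕ, 0 < n₀ ∧ ∀ n : ℕ, n₀ ≤ n →
      ∃ A : Fin t → ℕ, (∑ i, A i) = n ∧
        ∀ p : ℕ, (p : ℝ) < c * Real.logb 2 n → ¬ Pourable p A := by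
  obtain ⟨k, rfl⟩ : ∃ k, t = k + 1 := ⟨t - 1, by omega⟩
  have hk : (0 : ℝ) < k + 1 := by positivity
  refine ⟨1 / (4 * (k + 1)), by positivity, 2 ^ (8 * (k + 1)), by positivity, fun n hn => ?_⟩
  have hn0 : (0 : ℝ) < n := by exact_mod_cast lt_of_lt_of_le (by positivity) hn
  have hlog : (8 * (k + 1) : ℝ) ≤ Real.logb 2 n := by
    rw [Real.le_logb_iff_rpow_le one_lt_two hn0]
    exact_mod_cast hn
  set P := ⌊1 / (4 * (k + 1)) * Real.logb 2 n⌋₊ with hP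
  have hPle : (P : ℝ) ≤ 1 / (4 * (k + 1)) * Real.logb 2 n :=
    Nat.floor_le (mul_nonneg (by positivity) (by linarith))
  have hPmul : (P : ℝ) * (4 * (k + 1)) ≤ Real.logb 2 n := by
    rwa [one_div_mul_eq_div, le_div_iff₀ (by positivity)] at hPle
  have hpow : 2 ^ ((k + 1) * (2 * P + 4)) ≤ n := by
    have : (((k + 1) * (2 * P + 4) : ℕ) : ℝ) ≤ Real.logb 2 n := by
      push_cast
      linarith
    rw [Real.le_logb_iff_rpow_le one_lt_two hn0, Real.rpow_natCast] at this
    exact_mod_cast this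
  obtain ⟨A, hA, hnp⟩ := exists_not_pourable (k := k) (n := n) (p := P) (by omega) <|
    calc (k + 1) ^ (2 * P + 4) ≤ (2 ^ (k + 1)) ^ (2 * P + 4) :=
          Nat.pow_le_pow_left Nat.lt_two_pow_self.le _
      _ = 2 ^ ((k + 1) * (2 * P + 4)) := (pow_mul _ _ _).symm
      _ ≤ n := hpow
  exact ⟨A, hA, fun p hp h => hnp (h.mono (Nat.le_floor hp.le))⟩
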